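/- There is no finite group K with a Kantor family (F, F*) having distinct members A, B ∈ F such that A* ∩ B* is contained in the center Z(K), the quotient K/(A* ∩ B*) is abelian, the center Z(K) has exponent exactly 4, and every member of F is elementary abelian (exponent dividing 2). In other words, Frohardt's class (3) is empty. -/

import Mathlib

/-- A Kantor family of type `(u, v)` in a finite group `K` of order `u² * v`. -/
structure KantorFamily (K : Type*) [Group K] [Fintype K] (u v : ℕ) : Type _ where
  F : Finset (Subgroup K)
  star : Subgroup K → Subgroup K
  two_le_u : 2 ≤ u
  two_le_v : 2 ≤ v
  card_K : Fintype.card K = u ^ 2 * v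
  card_F : F.card = v + 1
  star_injOn : ∀ A ∈ F, ∀ B ∈ F, star A = star B → A = B
  le_star : ∀ A ∈ F, A ≤ star A
  card_mem : ∀ A ∈ F, Nat.card A = u
  card_star : ∀ A ∈ F, Nat.card (star A) = u * v
  prod_inter : ∀ A ∈ F, ∀ B ∈ F, ∀ C ∈ F, A ≠ B → B ≠ C → A ≠ C →
    ∀ g : K, (∃ a ∈ A, ∃ b ∈ B, g = a * b) → g ∈ C → g = 1
  inter_star : ∀ A ∈ F, ∀ B ∈ F, A ≠ B → ∀ g : K, g ∈ A → g ∈ star B → g = 1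


lemma gauss_div (n : ℕ) : ∀ S : GaussianInt, S.norm = 2 ^ n →
    ∃ W : GaussianInt, S = (⟨1, 1⟩ : GaussianInt) ^ n * W ∧ W.norm = 1 := by
  induction n with
  | zero => intro S h; exact ⟨S, by simp, by simpa using h⟩
  | succ n ih =>
    intro S h
    have h2 : S.re * S.re + S.im * S.im = 2 ^ (n + 1) := by
      rw [← h, Zsqrtd.norm_def]; ring
    have hpar : (S.re + S.im) % 2 = 0 := by
      have : (S.re * S.re + S.im * S.im) % 2 = 0 := by rw [h2, pow_succ]; simp
      rcases Int.emod_two_eq_zero_or_one S.re with h1 | h1 <;>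
      rcases Int.emod_two_eq_zero_or_one S.im with h3 | h3 <;>
      simp [Int.add_emod, Int.mul_emod, h1, h3] at this ⊢
    obtain ⟨k, hk⟩ := Int.dvd_of_emod_eq_zero hpar
    have hS : S = (⟨1, 1⟩ : GaussianInt) * ⟨k, k - S.re⟩ := by
      ext
      · simp
      · simp; linarith
    obtain ⟨W, hW, hW1⟩ := ih ⟨k, k - S.re⟩ (by
      have := congrArg Zsqrtd.norm hS
      rw [h, Zsqrtd.norm_mul, pow_succ] at this
      have h11 : (⟨1, 1⟩ : GaussianInt).norm = 2 := by simp [Zsqrtd.norm_def]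
      rw [h11] at this
      linarith)
    exact ⟨W, by rw [hS, hW, pow_succ]; ring, hW1⟩

lemma parity_norm (x : GaussianInt) : ((x.norm : ℤ) : ZMod 2) = ((x.re + x.im : ℤ) : ZMod 2) := by
  have key : ∀ a b : ZMod 2, a * a + b * b = a + b := by decide
  rw [Zsqrtd.norm_def]
  push_cast
  rw [← key]; ring

lemma arith {I : Type*} [Fintype I] (n w : ℕ) (hn : 1 ≤ n) (hI : Fintype.card I + 1 = 2 ^ n * w)
    (S : I → GaussianInt) (hS : ∀ i, (S i).norm = 2 ^ n)
    (hsum : ∑ i, S i = ((2 ^ n * ((w : ℤ) - 1) : ℤ) : GaussianInt)) : False := by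
  choose W hW hW1 using fun i => gauss_div n (S i) (hS i)
  simp_rw [hW, ← Finset.mul_sum] at hsum
  have h11 : (⟨1, 1⟩ : GaussianInt).norm = 2 := by simp [Zsqrtd.norm_def]
  have hp : ∀ k : ℕ, ((⟨1, 1⟩ : GaussianInt) ^ k).norm = 2 ^ k := by
    intro k
    induction k with
    | zero => simp
    | succ k ih => rw [pow_succ, Zsqrtd.norm_mul, ih, h11, pow_succ]
  have h1 := congrArg Zsqrtd.norm hsum
  rw [Zsqrtd.norm_mul, hp, Zsqrtd.norm_intCast] at h1
  have h2 : (∑ i, W i).norm = 2 ^ n * ((w : ℤ) - 1) ^ 2 := by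
    have : (2 : ℤ) ^ n ≠ 0 := by positivity
    apply mul_left_cancel₀ this
    rw [h1]; ring
  have h20 : (2 : ZMod 2) = 0 := by decide
  have h3 : (((∑ i, W i).norm : ℤ) : ZMod 2) = 0 := by
    rw [h2]; push_cast; rw [h20, zero_pow (by omega), zero_mul]
  let p : GaussianInt →+ ZMod 2 :=
    { toFun := fun x => ((x.re + x.im : ℤ) : ZMod 2)
      map_zero' := by simp
      map_add' := by intro x y; simp; ring }
  have hpn : ∀ x, p x = (x.norm : ZMod 2) := fun x => (parity_norm x).symm
  rw [← hpn, map_sum] at h3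
  simp_rw [hpn, hW1] at h3
  simp at h3
  have h4 := congrArg (Nat.cast : ℕ → ZMod 2) hI
  push_cast at h4
  rw [h20, zero_pow (by omega), h3] at h4
  simp at h4

lemma unit_star (x : GaussianIntˣ) : (x : GaussianInt) * star (x : GaussianInt) = 1 := by
  have h := Zsqrtd.norm_eq_one_iff' (d := -1) (by norm_num) (x : GaussianInt)
  have h2 := h.2 x.isUnit
  have h3 := Zsqrtd.norm_eq_mul_conj (x : GaussianInt)
  rw [h2] at h3
  simpa using h3.symm

instance : HasEnoughRootsOfUnity GaussianInt 4 where
  prim := ⟨⟨0, 1⟩, by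
    apply IsPrimitiveRoot.mk_of_lt _ (by norm_num) (by decide)
    intro l h1 h2
    interval_cases l <;> decide⟩
  cyc := rootsOfUnity.isCyclic _ _


lemma core {A B D I : Type*} [CommGroup A] [CommGroup B] [CommGroup D] [Fintype A] [Fintype D]
    [Fintype I] (n : ℕ) (hn : 1 ≤ n) (hA : Fintype.card A = 2 ^ n)
    (hI : Fintype.card I + 1 = Fintype.card D)
    (hD4 : ∀ d : D, d ^ 4 = 1) (hD2 : ∃ d : D, d ^ 2 ≠ 1)
    (κ : A → B →* D) (hκ : ∀ a b, κ a b ^ 2 = 1)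
    (φ : I → A →* B) (hφ : ∀ i, Function.Surjective (φ i))
    (z : I → A → D) (hz : ∀ i a a', z i (a * a') = z i a * z i a' * κ a' (φ i a))
    (hzz : ∀ i a, z i a ^ 2 * κ a (φ i a) = 1)
    (hz1 : ∀ i a, z i a = 1 → a = 1)
    (hinj : ∀ a, a ≠ 1 → Function.Injective (fun i => z i a)) : False := by
  classical
  obtain ⟨d0, hd0⟩ := hD2
  have hdvd : Monoid.exponent D ∣ 4 := Monoid.exponent_dvd_of_forall_pow_eq_one hD4
  have : NeZero (4 : ℕ) := ⟨by norm_num⟩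
  have : HasEnoughRootsOfUnity GaussianInt (Monoid.exponent D) :=
    HasEnoughRootsOfUnity.of_dvd GaussianInt hdvd
  obtain ⟨ψ, hψ⟩ := CommGroup.exists_apply_ne_one_of_hasEnoughRootsOfUnity D GaussianInt hd0
  have hz11 : ∀ i, z i 1 = 1 := by
    intro i
    have := hz i 1 1
    simpa using this
  let χ : D →* GaussianInt := (Units.coeHom GaussianInt).comp ψ
  have hχd0 : χ (d0 ^ 2) ≠ 1 := by
    intro h
    exact hψ (Units.ext h)
  have hχ1 : χ ≠ 1 := by
    intro h
    apply hχd0; rw [h]; rfl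
  let χ2 : D →* GaussianInt := χ.comp (powMonoidHom 2)
  have hχ21 : χ2 ≠ 1 := by
    intro h
    apply hχd0
    exact DFunLike.congr_fun h d0
  -- bijection
  have himage : ∀ a, a ≠ 1 → Finset.univ.image (fun i => z i a) = Finset.univ.erase 1 := by
    intro a ha
    apply Finset.eq_of_subset_of_card_le
    · intro d hd
      simp only [Finset.mem_image, Finset.mem_univ, true_and] at hd
      obtain ⟨i, rfl⟩ := hd
      simp only [Finset.mem_erase, Finset.mem_univ, and_true]
      exact fun h => ha (hz1 i a h)
    · rw [Finset.card_image_of_injective _ (hinj a ha), Finset.card_erase_of_mem (Finset.mem_univ _),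
        Finset.card_univ, Finset.card_univ]
      omega
  have hsumI : ∀ f : D →* GaussianInt, f ≠ 1 → ∀ a, a ≠ 1 → ∑ i, f (z i a) = -1 := by
    intro f hf a ha
    have h1 : ∑ i, f (z i a) = ∑ d ∈ Finset.univ.image (fun i => z i a), f d := by
      rw [Finset.sum_image]
      intro x _ y _ hxy
      exact hinj a ha hxy
    rw [h1, himage a ha]
    have h2 := Finset.add_sum_erase Finset.univ (fun d => f d) (Finset.mem_univ 1)
    have h3 : ∑ d, f d = 0 := by
      exact sum_hom_units_eq_zero f hf
    simp only [map_one] at h2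
    rw [h3] at h2
    linear_combination h2
  have htotal : ∀ f : D →* GaussianInt, f ≠ 1 →
      ∑ i, ∑ a, f (z i a) = (Fintype.card D : GaussianInt) - (2 : GaussianInt) ^ n := by
    intro f hf
    rw [Finset.sum_comm, ← Finset.add_sum_erase Finset.univ _ (Finset.mem_univ 1)]
    rw [Finset.sum_congr rfl (fun a ha => hsumI f hf a (Finset.ne_of_mem_erase ha))]
    simp only [hz11, map_one, Finset.sum_const, Finset.card_univ,
      Finset.card_erase_of_mem (Finset.mem_univ _), hA, ← hI]
    have : ((2 ^ n - 1 : ℕ) : GaussianInt) = 2 ^ n - 1 := by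
      rw [Nat.cast_sub Nat.one_le_two_pow]; simp
    simp only [nsmul_eq_mul, this]
    push_cast
    ring
  -- divisibility
  have hdiv : ∃ w : ℕ, Fintype.card D = 2 ^ n * w := by
    let q : I → A →* GaussianInt := fun i =>
      { toFun := fun a => χ2 (z i a)
        map_one' := by simp [hz11]
        map_mul' := by
          intro a a'
          rw [hz]
          have : χ2 (κ a' (φ i a)) = 1 := by
            change χ ((κ a' (φ i a)) ^ 2) = 1
            rw [hκ, map_one]
          rw [map_mul, map_mul, this, mul_one] }
    have h1 := htotal χ2 hχ21
    have h2 : ∀ i, ∑ a, χ2 (z i a) = ((if q i = 1 then (2 : ℤ) ^ n else 0 : ℤ) : GaussianInt) := by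
      intro i
      have := sum_hom_units (q i)
      rw [hA] at this
      refine Eq.trans this ?_
      split_ifs <;> simp
    rw [Finset.sum_congr rfl (fun i _ => h2 i), ← Int.cast_sum] at h1
    have h3 : (∑ i, (if q i = 1 then (2 : ℤ) ^ n else 0 : ℤ)) = (Fintype.card D : ℤ) - 2 ^ n := by
      have : ((Fintype.card D : GaussianInt) - 2 ^ n) = (((Fintype.card D : ℤ) - 2 ^ n : ℤ) : GaussianInt) := by
        push_cast; rfl
      rw [this] at h1
      exact Int.cast_injective h1
    have h4 : (2 : ℤ) ^ n ∣ ∑ i, (if q i = 1 then (2 : ℤ) ^ n else 0 : ℤ) := by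
      apply Finset.dvd_sum
      intro i _
      split_ifs <;> simp
    rw [h3] at h4
    have h5 : (2 : ℤ) ^ n ∣ (Fintype.card D : ℤ) := by
      have := dvd_add h4 (dvd_refl _)
      simpa using this
    have h6 : 2 ^ n ∣ Fintype.card D := by exact_mod_cast h5
    exact h6
  obtain ⟨w, hw⟩ := hdiv
  -- nondegeneracy
  have hnd : ∀ a, a ≠ 1 → χ.comp (κ a) ≠ 1 := by
    intro a ha h
    have hd1 : d0 ∈ Finset.univ.image (fun i => z i a) := by
      rw [himage a ha]
      simp only [Finset.mem_erase, Finset.mem_univ, and_true]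
      rintro rfl
      simp at hd0
    simp only [Finset.mem_image, Finset.mem_univ, true_and] at hd1
    obtain ⟨i, hi⟩ := hd1
    have h1 := hzz i a
    rw [hi] at h1
    have h2 := congrArg χ h1
    have h3 : χ (κ a (φ i a)) = 1 := DFunLike.congr_fun h (φ i a)
    rw [map_mul, h3, mul_one, map_one] at h2
    exact hχd0 h2
  have hstar : ∀ d, χ d * star (χ d) = 1 := fun d => unit_star (ψ d)
  refine arith (I := I) n w hn (by rw [hI, hw]) (fun i => ∑ a, χ (z i a)) ?_ ?_
  · intro i
    have h1 : (∑ a, χ (z i a)) * star (∑ a, χ (z i a)) = 2 ^ n := by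
      rw [star_sum, Finset.mul_sum]
      have h2 : ∀ a' : A, (∑ a, χ (z i a)) * star (χ (z i a'))
          = ∑ e, χ (z i e) * χ (κ e (φ i a')) := by
        intro a'
        rw [← Equiv.sum_comp (Equiv.mulLeft a') (fun a => χ (z i a)), Finset.sum_mul]
        apply Finset.sum_congr rfl
        intro e _
        rw [Equiv.coe_mulLeft, hz, map_mul, map_mul]
        linear_combination (χ (z i e) * χ (κ e (φ i a'))) * hstar (z i a')
      rw [Finset.sum_congr rfl (fun a' _ => h2 a'), Finset.sum_comm]
      rw [Finset.sum_eq_single 1]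
      · have : ∀ a', κ 1 (φ i a') = 1 := by
          intro a'
          have := hz i a' 1
          simpa [hz11] using this
        simp [this, hz11, hA]
      · intro e _ he
        rw [← Finset.mul_sum]
        have : ∑ a', (χ.comp ((κ e).comp (φ i))) a' = 0 := by
          apply sum_hom_units_eq_zero
          intro h
          apply hnd e he
          ext b : 1
          obtain ⟨a, rfl⟩ := hφ i b
          exact DFunLike.congr_fun h a
        have h0 : ∑ a', χ (κ e (φ i a')) = 0 := this
        rw [h0, mul_zero]
      · simp
    have h3 := Zsqrtd.norm_eq_mul_conj (∑ a, χ (z i a))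
    rw [h1] at h3
    have : ((2 : GaussianInt) ^ n) = (((2 : ℤ) ^ n : ℤ) : GaussianInt) := by push_cast; rfl
    rw [this] at h3
    exact Int.cast_injective h3
  · rw [htotal χ hχ1, hw]
    push_cast
    ring

theorem frohardt_class_three_empty :
    ¬ ∃ (K : Type) (_ : Group K) (_ : Fintype K) (u v : ℕ)
        (KF : KantorFamily K u v) (A B : Subgroup K),
        A ∈ KF.F ∧ B ∈ KF.F ∧ A ≠ B ∧
        KF.star A ⊓ KF.star B ≤ Subgroup.center K ∧
        (∀ g h : K, g⁻¹ * h⁻¹ * g * h ∈ KF.star A ⊓ KF.star B) ∧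
        (∀ z ∈ Subgroup.center K, z ^ 4 = 1) ∧
        (∃ z ∈ Subgroup.center K, z ^ 2 ≠ 1) ∧
        (∀ C ∈ KF.F, ∀ x ∈ C, x ^ 2 = 1) := by
  rintro ⟨K, _, _, u, v, KF, A, B, hA, hB, hAB, hcen, hcom, h4, ⟨z0, hz0, hz02⟩, h2⟩
  classical
  have hu0 : 0 < u := by have := KF.two_le_u; omega
  have hv0 : 0 < v := by have := KF.two_le_v; omega
  have hcardK : Nat.card K = u ^ 2 * v := by rw [Nat.card_eq_fintype_card]; exact KF.card_K
  obtain ⟨D, hD⟩ : ∃ D : Subgroup K, D = KF.star A ⊓ KF.star B := ⟨_, rfl⟩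
  rw [← hD] at hcen hcom
  have hDA : ∀ d ∈ D, d ∈ KF.star A := by intro d hd; rw [hD] at hd; exact hd.1
  have hDB : ∀ d ∈ D, d ∈ KF.star B := by intro d hd; rw [hD] at hd; exact hd.2
  have hc : ∀ d ∈ D, ∀ g : K, g * d = d * g := fun d hd g => Subgroup.mem_center_iff.1 (hcen hd) g
  -- factorisation K = P * star Q
  have hfac : ∀ P ∈ KF.F, ∀ Q ∈ KF.F, P ≠ Q → ∀ k : K, ∃ p ∈ P, ∃ q ∈ KF.star Q, k = p * q := by
    intro P hP Q hQ hPQ k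
    let f : P × KF.star Q → K := fun x => x.1 * x.2
    have hf : Function.Injective f := by
      rintro ⟨p, q⟩ ⟨p', q'⟩ h
      have h' : (p : K) * q = p' * q' := h
      have h1 : (p' : K)⁻¹ * p = q' * (q : K)⁻¹ := by
        rw [inv_mul_eq_iff_eq_mul, ← mul_assoc, ← h', mul_inv_cancel_right]
      have h3 := KF.inter_star P hP Q hQ hPQ ((p' : K)⁻¹ * p)
        (P.mul_mem (P.inv_mem p'.2) p.2) (h1 ▸ (KF.star Q).mul_mem q'.2 ((KF.star Q).inv_mem q.2))
      have h5 : (p : K) = p' := (inv_mul_eq_one.1 h3).symm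
      rw [h5] at h'
      have h6 := mul_left_cancel h'
      exact Prod.ext (Subtype.ext h5) (Subtype.ext h6)
    have hb := hf.bijective_of_nat_card_le (by
      rw [Nat.card_prod, KF.card_mem P hP, KF.card_star Q hQ, hcardK]
      apply le_of_eq; ring)
    obtain ⟨⟨p, q⟩, hpq⟩ := hb.2 k
    exact ⟨p, p.2, q, q.2, hpq.symm⟩
  have hex : ∀ k : K, ∃ (a : A) (b : B) (d : D), k = a * b * d := by
    intro k
    obtain ⟨a, ha, k', hk', rfl⟩ := hfac A hA B hB hAB k
    obtain ⟨b, hb, d, hd, rfl⟩ := hfac B hB A hA hAB.symm k'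
    have hdB : d ∈ KF.star B := by
      have := (KF.star B).mul_mem ((KF.star B).inv_mem (KF.le_star B hB hb)) hk'
      simpa using this
    exact ⟨⟨a, ha⟩, ⟨b, hb⟩, ⟨d, by rw [hD]; exact ⟨hd, hdB⟩⟩, by simp [mul_assoc]⟩
  have huniq : ∀ (a a' : A) (b b' : B) (d d' : D), (a : K) * b * d = a' * b' * d' →
      a = a' ∧ b = b' ∧ d = d' := by
    intro a a' b b' d d' h
    have h1 : (a' : K)⁻¹ * a = b' * d' * (d : K)⁻¹ * (b : K)⁻¹ := by
      have h0 : (a : K) = a' * b' * d' * (d : K)⁻¹ * (b : K)⁻¹ := by rw [← h]; group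
      rw [h0]; group
    have h3 := KF.inter_star A hA B hB hAB ((a' : K)⁻¹ * a)
      (A.mul_mem (A.inv_mem a'.2) a.2) (by
        rw [h1]
        have hb := KF.le_star B hB b.2
        have hb' := KF.le_star B hB b'.2
        have hd := hDB _ d.2
        have hd' := hDB _ d'.2
        exact mul_mem (mul_mem (mul_mem hb' hd') (inv_mem hd)) (inv_mem hb))
    have h5 : (a : K) = a' := (inv_mul_eq_one.1 h3).symm
    rw [h5, mul_assoc, mul_assoc] at h
    have h := mul_left_cancel h
    have h6 : (b' : K)⁻¹ * b = d' * (d : K)⁻¹ := by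
      rw [inv_mul_eq_iff_eq_mul, ← mul_assoc, ← h, mul_inv_cancel_right]
    have h7 := KF.inter_star B hB A hA hAB.symm ((b' : K)⁻¹ * b)
      (B.mul_mem (B.inv_mem b'.2) b.2) (by
        rw [h6]
        exact mul_mem (hDA _ d'.2) (inv_mem (hDA _ d.2)))
    have h8 : (b : K) = b' := (inv_mul_eq_one.1 h7).symm
    rw [h8] at h
    exact ⟨Subtype.ext h5, Subtype.ext h8, Subtype.ext (mul_left_cancel h)⟩
  -- card D
  have hcardD : Nat.card D = v := by
    have hb : Function.Bijective (fun x : A × B × D => (x.1 : K) * x.2.1 * x.2.2) := by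
      constructor
      · rintro ⟨a, b, d⟩ ⟨a', b', d'⟩ h
        obtain ⟨h1, h2, h3⟩ := huniq a a' b b' d d' h
        rw [h1, h2, h3]
      · intro k
        obtain ⟨a, b, d, h⟩ := hex k
        exact ⟨⟨a, b, d⟩, h.symm⟩
    have := Nat.card_eq_of_bijective _ hb
    rw [Nat.card_prod, Nat.card_prod, KF.card_mem A hA, KF.card_mem B hB, hcardK] at this
    have h9 : u ^ 2 * Nat.card D = u ^ 2 * v := by rw [← this]; ring
    exact Nat.eq_of_mul_eq_mul_left (by positivity) h9
  choose α β ζ hk using hex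
  have hαβζ : ∀ (a : A) (b : B) (d : D), α (a * b * d) = a ∧ β (a * b * d) = b ∧ ζ (a * b * d) = d := by
    intro a b d
    exact huniq _ _ _ _ _ _ (hk (a * b * d)).symm
  -- commutativity
  have hcomm : ∀ C ∈ KF.F, ∀ x y : C, x * y = y * x := by
    intro C hC x y
    have h2' : ∀ x : C, x * x = 1 := fun x => Subtype.ext (by
      have := h2 C hC x x.2
      rw [pow_two] at this
      exact this)
    have hi : ∀ x : C, x⁻¹ = x := fun x => inv_eq_of_mul_eq_one_left (h2' x)
    rw [← hi (x * y), mul_inv_rev, hi, hi]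
  let iA : CommGroup A := { (inferInstance : Group A) with mul_comm := hcomm A hA }
  let iB : CommGroup B := { (inferInstance : Group B) with mul_comm := hcomm B hB }
  let iD : CommGroup D := { (inferInstance : Group D) with
    mul_comm := fun x y => Subtype.ext (hc y y.2 x) }
  have hκmem : ∀ (a : A) (b : B), (a : K)⁻¹ * b * a * (b : K)⁻¹ ∈ D := by
    intro a b
    have := hcom a (b : K)⁻¹
    rwa [inv_inv] at this
  let κ : A → B →* D := fun a => MonoidHom.mk' (fun b => ⟨(a : K)⁻¹ * b * a * (b : K)⁻¹, hκmem a b⟩) (by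
    intro b b'
    apply Subtype.ext
    have h := hc _ (hκmem a b') b
    change (a : K)⁻¹ * (b * b') * a * ((b : K) * b')⁻¹
      = ((a : K)⁻¹ * b * a * (b : K)⁻¹) * ((a : K)⁻¹ * b' * a * (b' : K)⁻¹)
    have h' := hc _ (hκmem a b') (b : K)⁻¹
    rw [mul_assoc ((a : K)⁻¹ * b * a), h']
    group)
  have hκdef : ∀ a b, ((κ a b : D) : K) = (a : K)⁻¹ * b * a * (b : K)⁻¹ := fun a b => rfl
  have hmul : ∀ k k' : K, k * k' =
      ((α k * α k' : A) : K) * ((β k * β k' : B) : K) * ((ζ k * ζ k' * κ (α k') (β k) : D) : K) := by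
    intro k k'
    have e1 := hk k
    have e2 := hk k'
    generalize α k = a at *
    generalize β k = b at *
    generalize ζ k = d at *
    generalize α k' = a' at *
    generalize β k' = b' at *
    generalize ζ k' = d' at *
    rw [e1, e2]
    have hba : (b : K) * a' = a' * (κ a' b : D) * b := by
      rw [hκdef]; group
    have c1 := hc _ (κ a' b).2
    have c2 := hc _ d.2
    push_cast
    generalize ((κ a' b : D) : K) = k at *
    calc (a : K) * b * d * (a' * b' * d') = a * b * (d * a') * b' * d' := by group
      _ = a * (b * a') * (d * b') * d' := by rw [← c2 a']; group
      _ = a * a' * (k * (b * b' * d * d')) := by rw [hba, ← c2 b']; group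
      _ = _ := by rw [← c1]; group
  have hαm : ∀ k k', α (k * k') = α k * α k' := fun k k' => by
    rw [hmul k k']; exact (hαβζ _ _ _).1
  have hβm : ∀ k k', β (k * k') = β k * β k' := fun k k' => by
    rw [hmul k k']; exact (hαβζ _ _ _).2.1
  have hζm : ∀ k k', ζ (k * k') = ζ k * ζ k' * κ (α k') (β k) := fun k k' => by
    conv_lhs => rw [hmul k k']
    exact (hαβζ _ _ _).2.2
  have hone := hαβζ 1 1 1
  simp only [Subgroup.coe_one, mul_one] at hone
  obtain ⟨hα1, hβ1, hζ1⟩ := hone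
  let αh : K →* A := MonoidHom.mk' α hαm
  let βh : K →* B := MonoidHom.mk' β hβm
  let I := {C // C ∈ KF.F ∧ C ≠ A ∧ C ≠ B}
  have hαinj : ∀ C : I, ∀ c ∈ C.1, α c = 1 → c = 1 := by
    rintro ⟨C, hC, hCA, hCB⟩ c hc' h
    apply KF.inter_star C hC B hB hCB c hc'
    rw [hk c, h]
    simpa using mul_mem (KF.le_star B hB (β c).2) (hDB _ (ζ c).2)
  have hβinj : ∀ C : I, ∀ c ∈ C.1, β c = 1 → c = 1 := by
    rintro ⟨C, hC, hCA, hCB⟩ c hc' h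
    apply KF.inter_star C hC A hA hCA c hc'
    rw [hk c, h]
    simpa using mul_mem (KF.le_star A hA (α c).2) (hDA _ (ζ c).2)
  have hαbij : ∀ C : I, Function.Bijective (αh.comp C.1.subtype) := by
    intro C
    apply Function.Injective.bijective_of_nat_card_le
    · rw [injective_iff_map_eq_one]
      intro c h
      exact Subtype.ext (hαinj C c c.2 h)
    · rw [KF.card_mem A hA, KF.card_mem C.1 C.2.1]
  have hβbij : ∀ C : I, Function.Bijective (βh.comp C.1.subtype) := by
    intro C
    apply Function.Injective.bijective_of_nat_card_le
    · rw [injective_iff_map_eq_one]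
      intro c h
      exact Subtype.ext (hβinj C c c.2 h)
    · rw [KF.card_mem B hB, KF.card_mem C.1 C.2.1]
  let e : ∀ C : I, C.1 ≃* A := fun C => MulEquiv.ofBijective _ (hαbij C)
  let s : I → A →* K := fun C => C.1.subtype.comp (e C).symm.toMonoidHom
  have hsmem : ∀ C a, s C a ∈ C.1 := fun C a => ((e C).symm a).2
  have hsα : ∀ C a, α (s C a) = a := fun C a => (e C).apply_symm_apply a
  have hs1 : ∀ C a, s C a = 1 → a = 1 := by
    intro C a h
    rw [← hsα C a, h, hα1]
  -- the order of A
  obtain ⟨n, hn⟩ : ∃ n, Nat.card A = 2 ^ n := by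
    have : Fact (Nat.Prime 2) := ⟨Nat.prime_two⟩
    have hp : IsPGroup 2 A := by
      intro a
      refine ⟨1, Subtype.ext ?_⟩
      simpa using h2 A hA a a.2
    exact IsPGroup.iff_card.1 hp
  have hn1 : 1 ≤ n := by
    rcases Nat.eq_zero_or_pos n with rfl | h
    · rw [KF.card_mem A hA] at hn
      have := KF.two_le_u
      simp at hn; omega
    · exact h
  have hcI : Fintype.card I + 1 = Fintype.card D := by
    rw [← Nat.card_eq_fintype_card (α := D), hcardD]
    have : Fintype.card I = ((KF.F.erase A).erase B).card := by
      apply Fintype.card_of_subtype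
      intro C
      simp only [Finset.mem_erase]
      tauto
    rw [this, Finset.card_erase_of_mem (Finset.mem_erase.2 ⟨hAB.symm, hB⟩),
      Finset.card_erase_of_mem hA, KF.card_F]
    omega
  refine core (A := A) (B := B) (D := D) (I := I) n hn1 (by rw [← Nat.card_eq_fintype_card, hn]) hcI
    ?_ ?_ κ ?_ (fun C => βh.comp (s C)) ?_ (fun C a => ζ (s C a)) ?_ ?_ ?_ ?_
  · intro d
    exact Subtype.ext (by simpa using h4 d (hcen d.2))
  · refine ⟨ζ z0, fun h => hz02 ?_⟩
    have hzc := fun g => Subgroup.mem_center_iff.1 hz0 g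
    have e1 := hk z0
    have hd : ((ζ z0 : D) : K) ^ 2 = 1 := by rw [← Subgroup.coe_pow, h]; rfl
    have hcd := hc _ (ζ z0).2
    have ha2 := h2 A hA _ (α z0).2
    have hb2 := h2 B hB _ (β z0).2
    have hcb := hzc (β z0)
    generalize ((α z0 : A) : K) = a at *
    generalize ((β z0 : B) : K) = b at *
    generalize ((ζ z0 : D) : K) = d at *
    rw [e1] at hcb
    -- a and b commute
    have hab : a * b = b * a := by
      have h5 : b * (a * b) * d = (a * b) * b * d := by
        rw [mul_assoc (a * b) b d, hcd b, ← mul_assoc (a * b) d b, ← hcb]; group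
      have h6 := mul_right_cancel h5
      rw [← mul_assoc] at h6
      exact (mul_right_cancel h6).symm
    have : Commute a b := hab
    have h7 : Commute (a * b) d := hcd _
    rw [e1, h7.mul_pow, this.mul_pow, ha2, hb2, hd]; simp
  · intro a b
    rw [← map_pow]
    have : b ^ 2 = 1 := Subtype.ext (by simpa using h2 B hB b b.2)
    rw [this, map_one]
  · intro C
    exact (hβbij C).2.comp (e C).symm.surjective
  · intro C a a'
    change ζ (s C (a * a')) = ζ (s C a) * ζ (s C a') * κ a' (β (s C a))
    rw [map_mul, hζm, hsα]
  · intro C a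
    change ζ (s C a) ^ 2 * κ a (β (s C a)) = 1
    have h5 := hζm (s C a) (s C a)
    have h6 := h2 C.1 C.2.1 _ (hsmem C a)
    rw [pow_two] at h6
    rw [h6, hζ1, hsα] at h5
    rw [pow_two, ← h5]
  · intro C a h
    have h : ζ (s C a) = 1 := h
    apply hs1 C
    refine KF.prod_inter A hA B hB C.1 C.2.1 hAB C.2.2.2.symm C.2.2.1.symm _
      ⟨α (s C a), (α (s C a)).2, β (s C a), (β (s C a)).2, ?_⟩ (hsmem C a)
    conv_lhs => rw [hk (s C a), h]
    simp
  · intro a ha C C' h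
    have h : ζ (s C a) = ζ (s C' a) := h
    by_contra hne
    apply ha
    apply hs1 C
    refine KF.prod_inter C'.1 C'.2.1 B hB C.1 C.2.1 C'.2.2.2 C.2.2.2.symm
      (fun hh => hne (Subtype.ext hh.symm)) _
      ⟨s C' a, hsmem C' a, (β (s C' a) : K)⁻¹ * β (s C a),
        mul_mem (inv_mem (β (s C' a)).2) (β (s C a)).2, ?_⟩ (hsmem C a)
    have e1 := hk (s C a)
    have e2 := hk (s C' a)
    rw [hsα, h] at e1
    rw [hsα] at e2
    have c := hc _ (ζ (s C' a)).2
    generalize s C a = x at *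
    generalize s C' a = y at *
    generalize β y = b' at *
    generalize ζ y = d' at *
    rw [e2, mul_assoc _ (d' : K), ← c]
    refine e1.trans ?_
    group
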